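/- Let d ≥ 1, T > 0, r ∈ ℝ, a > 0, μ_1,…,μ_d ∈ ℝ, and σ_1,…,σ_d > 0. Let φ(x) := exp(−rT) · max(max_{1≤i≤d} x_i − a, 0), and let γ_d denote the standard Gaussian measure on ℝ^d. Define, for (t, x) ∈ [0, T) × (0, ∞)^d, u(t, x) := ∫_{ℝ^d} φ( x_1 e^{σ_1 √(T−t) z_1 + (μ_1 − σ_1²/2)(T−t)}, …, x_d e^{σ_d √(T−t) z_d + (μ_d − σ_d²/2)(T−t)} ) dγ_d(z). Then on (0, T) × (0, ∞)^d, u is continuously differentiable in t and twice continuously differentiable in x, and it solves the Black–Scholes equation ∂_t u(t,x) + ½ Σ_{i=1}^d σ_i² x_i² ∂²u/∂x_i²(t,x) + Σ_{i=1}^d μ_i x_i ∂u/∂x_i(t,x) = 0; moreover, for every x ∈ (0, ∞)^d, u(t, x) → φ(x) as t → T⁻. -/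

import Mathlib

open MeasureTheory ProbabilityTheory

section ExponentialFamily

variable {Ω J : Type*} [MeasurableSpace Ω] [Fintype J] {m : Measure Ω} {τ : J → Ω → ℝ}
  {U : Set (J → ℝ)} {h : Ω → ℝ}

/-- The weight `h` is integrable against every member of the exponential family with sufficient
statistic `τ` and parameters in `U`. -/
def ExpIntegrable (m : Measure Ω) (τ : J → Ω → ℝ) (U : Set (J → ℝ)) (h : Ω → ℝ) : Prop :=
  ∀ θ ∈ U, Integrable (fun ω => h ω * Real.exp (∑ j, θ j * τ j ω)) m

/-- The weighted partition function of the exponential family with sufficient statistic `τ`. -/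
noncomputable def expIntegral (m : Measure Ω) (τ : J → Ω → ℝ) (h : Ω → ℝ) (θ : J → ℝ) : ℝ :=
  ∫ ω, h ω * Real.exp (∑ j, θ j * τ j ω) ∂m

lemma exp_mul_sum_abs_le_sum_exp_signs [DecidableEq J] (δ : ℝ) (v : J → ℝ) :
    Real.exp (δ * ∑ j, |v j|) ≤
      ∑ s : J → Bool, Real.exp (∑ j, (if s j then δ else -δ) * v j) := by
  have key : ∑ j, (if decide (0 ≤ v j) then δ else -δ) * v j = δ * ∑ j, |v j| := by
    rw [Finset.mul_sum]
    refine Finset.sum_congr rfl fun j _ => ?_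
    by_cases hj : 0 ≤ v j
    · simp [hj, abs_of_nonneg hj]
    · simp [hj, abs_of_neg (not_le.1 hj)]
  rw [← key]
  exact Finset.single_le_sum (f := fun s : J → Bool =>
    Real.exp (∑ j, (if s j then δ else -δ) * v j)) (fun _ _ => (Real.exp_pos _).le)
    (Finset.mem_univ fun j => decide (0 ≤ v j))

lemma ExpIntegrable.exists_bound (hU : IsOpen U) (hh : ExpIntegrable m τ U h) {θ₀ : J → ℝ}
    (hθ₀ : θ₀ ∈ U) : ∃ ε > 0, ∃ B : Ω → ℝ, Integrable B m ∧ Metric.ball θ₀ ε ⊆ U ∧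
      ∀ ω, ∀ θ ∈ Metric.ball θ₀ ε,
        (∑ j, |τ j ω|) * |h ω * Real.exp (∑ j, θ j * τ j ω)| ≤ B ω := by
  classical
  obtain ⟨δ, hδ, hball⟩ := Metric.isOpen_iff.1 hU θ₀ hθ₀
  have hδ4 : 0 < δ / 4 := by positivity
  refine ⟨δ / 4, hδ4, fun ω => (4 / δ) * ∑ s : J → Bool, |h ω *
    Real.exp (∑ j, (θ₀ j + if s j then δ / 2 else -(δ / 2)) * τ j ω)|, ?_, ?_, ?_⟩
  · refine (integrable_finsetSum _ fun s _ => (hh _ (hball ?_)).abs).const_mul _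
    rw [Metric.mem_ball, dist_pi_lt_iff hδ]
    intro j
    rw [Real.dist_eq, add_sub_cancel_left]
    have habs : |δ / 2| < δ := by rw [abs_of_pos (by positivity)]; linarith
    split_ifs
    · exact habs
    · rwa [abs_neg]
  · exact (Metric.ball_subset_ball (by linarith)).trans hball
  · intro ω θ hθ
    set S := ∑ j, |τ j ω| with hS
    have hS0 : 0 ≤ S := Finset.sum_nonneg fun _ _ => abs_nonneg _
    have h1 : ∑ j, θ j * τ j ω ≤ ∑ j, θ₀ j * τ j ω + δ / 4 * S := by
      rw [hS, Finset.mul_sum, ← Finset.sum_add_distrib]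
      refine Finset.sum_le_sum fun j _ => ?_
      have hj : |θ j - θ₀ j| ≤ δ / 4 := by
        rw [← Real.dist_eq]
        exact (dist_le_pi_dist θ θ₀ j).trans (Metric.mem_ball.1 hθ).le
      have := (le_abs_self _).trans_eq (abs_mul (θ j - θ₀ j) (τ j ω))
      nlinarith [mul_le_mul_of_nonneg_right hj (abs_nonneg (τ j ω))]
    have h2 : S ≤ (4 / δ) * Real.exp (δ / 4 * S) := by
      have := Real.add_one_le_exp (δ / 4 * S)
      calc S = (4 / δ) * (δ / 4 * S) := by field_simp
        _ ≤ _ := by gcongr; linarith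
    have h3 := exp_mul_sum_abs_le_sum_exp_signs (δ / 2) fun j => τ j ω
    have hsplit : ∀ s : J → Bool,
        |h ω * Real.exp (∑ j, (θ₀ j + if s j then δ / 2 else -(δ / 2)) * τ j ω)| =
        |h ω| * Real.exp (∑ j, θ₀ j * τ j ω) *
          Real.exp (∑ j, (if s j then δ / 2 else -(δ / 2)) * τ j ω) := by
      intro s
      rw [abs_mul, Real.abs_exp, mul_assoc, ← Real.exp_add, ← Finset.sum_add_distrib]
      simp only [add_mul]
    simp only [hsplit, ← Finset.mul_sum]
    rw [abs_mul, Real.abs_exp]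
    calc S * (|h ω| * Real.exp (∑ j, θ j * τ j ω))
        ≤ ((4 / δ) * Real.exp (δ / 4 * S)) *
          (|h ω| * Real.exp (∑ j, θ₀ j * τ j ω + δ / 4 * S)) := by gcongr
      _ = (4 / δ) * (|h ω| * Real.exp (∑ j, θ₀ j * τ j ω) * Real.exp (δ / 2 * S)) := by
          rw [show δ / 2 * S = δ / 4 * S + δ / 4 * S by ring, Real.exp_add, Real.exp_add]
          ring
      _ ≤ _ := by gcongr

lemma ExpIntegrable.mul_stat (hτ : ∀ j, Measurable (τ j)) (hU : IsOpen U)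
    (hh : ExpIntegrable m τ U h) (i : J) : ExpIntegrable m τ U fun ω => τ i ω * h ω := by
  intro θ hθ
  obtain ⟨ε, hε, B, hB, -, hle⟩ := hh.exists_bound hU hθ
  refine hB.mono' ?_ (ae_of_all _ fun ω => ?_)
  · simp only [mul_assoc]
    exact (hτ i).aestronglyMeasurable.mul (hh θ hθ).aestronglyMeasurable
  · refine le_trans ?_ (hle ω θ (Metric.mem_ball_self hε))
    rw [mul_assoc, norm_mul, Real.norm_eq_abs, Real.norm_eq_abs]
    gcongr
    exact Finset.single_le_sum (f := fun j => |τ j ω|) (fun _ _ => abs_nonneg _)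
      (Finset.mem_univ i)

lemma ExpIntegrable.hasFDerivAt (hτ : ∀ j, Measurable (τ j)) (hU : IsOpen U)
    (hh : ExpIntegrable m τ U h) {θ : J → ℝ} (hθ : θ ∈ U) :
    HasFDerivAt (expIntegral m τ h)
      (∑ j, expIntegral m τ (fun ω => τ j ω * h ω) θ •
        (ContinuousLinearMap.proj j : (J → ℝ) →L[ℝ] ℝ)) θ := by
  obtain ⟨ε, hε, B, hB, hsub, hle⟩ := hh.exists_bound hU hθ
  have hint := fun j => hh.mul_stat hτ hU j θ hθ
  have hmeas : ∀ᶠ θ' in nhds θ, AEStronglyMeasurable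
      (fun ω => h ω * Real.exp (∑ j, θ' j * τ j ω)) m := by
    filter_upwards [hU.mem_nhds hθ] with θ' hθ' using (hh θ' hθ').aestronglyMeasurable
  have hbound : ∀ ω, ∀ θ' ∈ Metric.ball θ ε,
      ‖∑ j, ((τ j ω * h ω) * Real.exp (∑ j, θ' j * τ j ω)) •
        (ContinuousLinearMap.proj j : (J → ℝ) →L[ℝ] ℝ)‖ ≤ B ω := by
    intro ω θ' hθ'
    refine le_trans ?_ (hle ω θ' hθ')
    rw [Finset.sum_mul]
    refine (norm_sum_le _ _).trans (Finset.sum_le_sum fun j _ => ?_)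
    rw [norm_smul, mul_assoc, norm_mul, Real.norm_eq_abs, Real.norm_eq_abs]
    refine mul_le_of_le_one_right (by positivity) ?_
    refine ContinuousLinearMap.opNorm_le_bound _ zero_le_one fun v => ?_
    simpa using norm_le_pi_norm v j
  have hderiv : ∀ ω, ∀ θ' ∈ Metric.ball θ ε,
      HasFDerivAt (fun θ => h ω * Real.exp (∑ j, θ j * τ j ω))
        (∑ j, ((τ j ω * h ω) * Real.exp (∑ j, θ' j * τ j ω)) •
          (ContinuousLinearMap.proj j : (J → ℝ) →L[ℝ] ℝ)) θ' := by
    intro ω θ' _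
    have hlin : HasFDerivAt (fun θ : J → ℝ => ∑ j, θ j * τ j ω)
        (∑ j, τ j ω • (ContinuousLinearMap.proj j : (J → ℝ) →L[ℝ] ℝ)) θ' :=
      HasFDerivAt.fun_sum fun j _ => (hasFDerivAt_apply j θ').mul_const (τ j ω)
    refine (hlin.exp.const_mul (h ω)).congr_fderiv ?_
    rw [Finset.smul_sum, Finset.smul_sum]
    refine Finset.sum_congr rfl fun j _ => ?_
    rw [smul_smul, smul_smul]
    congr 1
    ring
  have hint' : ∀ j, Integrable (fun ω => ((τ j ω * h ω) * Real.exp (∑ j, θ j * τ j ω)) •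
      (ContinuousLinearMap.proj j : (J → ℝ) →L[ℝ] ℝ)) m := fun j => (hint j).smul_const _
  have hmeas' : AEStronglyMeasurable
      (fun ω => ∑ j, ((τ j ω * h ω) * Real.exp (∑ j, θ j * τ j ω)) •
        (ContinuousLinearMap.proj j : (J → ℝ) →L[ℝ] ℝ)) m :=
    Finset.aestronglyMeasurable_fun_sum _ fun j _ => (hint' j).aestronglyMeasurable
  have main := hasFDerivAt_integral_of_dominated_of_fderiv_le (Metric.ball_mem_nhds θ hε) hmeas
    (hh θ hθ) hmeas' (ae_of_all _ hbound) hB (ae_of_all _ hderiv)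
  refine main.congr_fderiv ?_
  refine (integral_finsetSum (G := (J → ℝ) →L[ℝ] ℝ) (μ := m) Finset.univ
    (f := fun j ω => ((τ j ω * h ω) * Real.exp (∑ j, θ j * τ j ω)) •
      (ContinuousLinearMap.proj j : (J → ℝ) →L[ℝ] ℝ)) fun j _ => hint' j).trans ?_
  exact Finset.sum_congr rfl fun j _ => integral_smul_const _ _

lemma ExpIntegrable.contDiffOn (hτ : ∀ j, Measurable (τ j)) (hU : IsOpen U)
    (hh : ExpIntegrable m τ U h) (n : ℕ) : ContDiffOn ℝ n (expIntegral m τ h) U := by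
  induction n generalizing h with
  | zero =>
    exact contDiffOn_zero.2 fun θ hθ =>
      (hh.hasFDerivAt hτ hU hθ).continuousAt.continuousWithinAt
  | succ n ih =>
    rw [Nat.cast_succ, contDiffOn_succ_iff_fderiv_of_isOpen hU]
    refine ⟨fun θ hθ => (hh.hasFDerivAt hτ hU hθ).differentiableAt.differentiableWithinAt,
      by simp, ?_⟩
    refine ContDiffOn.congr (f := fun θ => ∑ j, expIntegral m τ (fun ω => τ j ω * h ω) θ •
        (ContinuousLinearMap.proj j : (J → ℝ) →L[ℝ] ℝ)) ?_
        fun θ hθ => (hh.hasFDerivAt hτ hU hθ).fderiv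
    exact ContDiffOn.sum fun j _ => (ih (hh.mul_stat hτ hU j)).smul contDiffOn_const

end ExponentialFamily

section Gaussian

variable {ι : Type*} [Fintype ι]

lemma pi_gaussianReal_eq_withDensity :
    Measure.pi (fun _ : ι => gaussianReal 0 1) =
      volume.withDensity fun z : ι → ℝ => ENNReal.ofReal (∏ i, gaussianPDFReal 0 1 (z i)) := by
  refine Measure.pi_eq fun s hs => ?_
  have hprod : Integrable (fun z : ι → ℝ => ∏ i, gaussianPDFReal 0 1 (z i))
      (Measure.pi fun i => volume.restrict (s i)) :=
    Integrable.fintype_prod fun i => (integrable_gaussianPDFReal 0 1).restrict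
  rw [withDensity_apply _ (MeasurableSet.univ_pi hs), volume_pi, Measure.restrict_pi_pi,
    ← ofReal_integral_eq_lintegral_ofReal hprod
      (ae_of_all _ fun z => Finset.prod_nonneg fun i _ => gaussianPDFReal_nonneg 0 1 (z i)),
    integral_fintype_prod_eq_prod (fun _ => gaussianPDFReal 0 1),
    ENNReal.ofReal_prod_of_nonneg fun i _ => integral_nonneg (gaussianPDFReal_nonneg 0 1)]
  exact Finset.prod_congr rfl fun i _ => (gaussianReal_apply_eq_integral 0 one_ne_zero (s i)).symm

/-- The sufficient statistic of the isotropic Gaussian family: `∑ vᵢ²` and the `vᵢ`. -/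
def gaussianStat (ι : Type*) [Fintype ι] : Option ι → (ι → ℝ) → ℝ
  | none, v => ∑ i, v i ^ 2
  | some i, v => v i

/-- The natural parameter of the Gaussian with mean `b` and covariance `s • 1`. -/
noncomputable def gaussianParam {κ : Type*} (s : ℝ) (b : κ → ℝ) : Option κ → ℝ
  | none => -1 / (2 * s)
  | some i => b i / s

/-- The expectation of `h` under the Gaussian with mean `b` and covariance `s • 1`, that is, the
heat semigroup at time `s / 2` applied to `h`. -/
noncomputable def gaussianMean (h : (ι → ℝ) → ℝ) (s : ℝ) (b : ι → ℝ) : ℝ :=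
  (√(2 * Real.pi))⁻¹ ^ Fintype.card ι *
    (Real.exp (∑ i, (-(b i ^ 2 / (2 * s)) - Real.log s / 2)) *
      expIntegral volume (gaussianStat ι) h (gaussianParam s b))

lemma measurable_gaussianStat (j : Option ι) : Measurable (gaussianStat ι j) := by
  cases j with
  | none =>
    change Measurable fun v : ι → ℝ => ∑ i, v i ^ 2
    fun_prop
  | some i => exact measurable_pi_apply i

lemma sum_param_mul_gaussianStat (θ : Option ι → ℝ) (v : ι → ℝ) :
    ∑ j, θ j * gaussianStat ι j v = ∑ i, (θ none * v i ^ 2 + θ (some i) * v i) := by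
  rw [Fintype.sum_option, Finset.sum_add_distrib, ← Finset.mul_sum]
  rfl

lemma isOpen_gaussianDomain {κ : Type*} : IsOpen {θ : Option κ → ℝ | θ none < 0} :=
  isOpen_lt (continuous_apply none) continuous_const

lemma gaussianParam_mem {κ : Type*} {s : ℝ} (hs : 0 < s) (b : κ → ℝ) :
    gaussianParam s b ∈ {θ : Option κ → ℝ | θ none < 0} :=
  show -1 / (2 * s) < 0 from div_neg_of_neg_of_pos (by norm_num) (by positivity)

lemma integral_pi_gaussianReal_affine {s : ℝ} (hs : 0 < s) (b : ι → ℝ) (F : (ι → ℝ) → ℝ) :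
    ∫ z, F (fun i => √s * z i + b i) ∂Measure.pi (fun _ : ι => gaussianReal 0 1) =
      gaussianMean F s b := by
  have hr : 0 < √s := Real.sqrt_pos.2 hs
  have hmeas : Measurable fun z : ι → ℝ => ∏ i, gaussianPDFReal 0 1 (z i) :=
    Finset.measurable_fun_prod _ fun i _ =>
      (measurable_gaussianPDFReal 0 1).comp (measurable_pi_apply i)
  rw [pi_gaussianReal_eq_withDensity, integral_withDensity_eq_integral_toReal_smul
    hmeas.ennreal_ofReal (ae_of_all _ fun _ => ENNReal.ofReal_lt_top)]
  simp only [ENNReal.toReal_ofReal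
    (Finset.prod_nonneg fun i _ => gaussianPDFReal_nonneg 0 1 _), smul_eq_mul]
  set G : (ι → ℝ) → ℝ := fun z =>
    (∏ i, gaussianPDFReal 0 1 (z i)) * F (fun i => √s * z i + b i) with hG
  have h1 := Measure.integral_comp_inv_smul_of_nonneg (volume : Measure (ι → ℝ)) G hr.le
  rw [← integral_sub_right_eq_self (fun v => G ((√s)⁻¹ • v)) b, Module.finrank_pi,
    smul_eq_mul] at h1
  have h2 : ∫ z, G z = ((√s)⁻¹) ^ Fintype.card ι * ∫ v, G ((√s)⁻¹ • (v - b)) := by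
    rw [h1, ← mul_assoc, ← mul_pow, inv_mul_cancel₀ hr.ne', one_pow, one_mul]
  rw [h2, gaussianMean, expIntegral, ← integral_const_mul, ← integral_const_mul,
    ← integral_const_mul]
  refine integral_congr_ae (ae_of_all _ fun v => ?_)
  have hv : (fun i => √s * ((√s)⁻¹ • (v - b)) i + b i) = v := by
    ext i
    simp only [Pi.smul_apply, Pi.sub_apply, smul_eq_mul]
    field_simp
    ring
  have hlog : ∀ i, Real.exp (-(b i ^ 2 / (2 * s)) - Real.log s / 2) =
      Real.exp (-(b i ^ 2 / (2 * s))) * (√s)⁻¹ := by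
    intro i
    rw [sub_eq_add_neg, Real.exp_add, Real.exp_neg (Real.log s / 2), ← Real.log_sqrt hs.le,
      Real.exp_log hr]
  have hexp : ∀ i, Real.exp (-((√s)⁻¹ • (v - b)) i ^ 2 / 2) =
      Real.exp (-(b i ^ 2 / (2 * s))) *
        Real.exp (-1 / (2 * s) * v i ^ 2 + b i / s * v i) := by
    intro i
    rw [← Real.exp_add]
    congr 1
    simp only [Pi.smul_apply, Pi.sub_apply, smul_eq_mul, mul_pow, inv_pow, Real.sq_sqrt hs.le]
    field_simp
    ring
  simp only [hG, hv]
  rw [sum_param_mul_gaussianStat]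
  simp only [Real.exp_sum, gaussianParam, gaussianPDFReal, hlog, NNReal.coe_one, mul_one,
    sub_zero, hexp, Finset.prod_mul_distrib, Finset.prod_const, Finset.card_univ]
  ring

lemma integrable_exp_quadratic {α : ℝ} (hα : α < 0) (β : ℝ) :
    Integrable fun x : ℝ => Real.exp (α * x ^ 2 + β * x) := by
  have := (integrable_cexp_quadratic' (b := (α : ℂ)) (by simpa using hα) β 0).norm
  refine this.congr (ae_of_all _ fun x => ?_)
  simp only [Complex.norm_exp]
  congr 1
  simp [← Complex.ofReal_pow]

lemma expIntegrable_gaussianStat {h : (ι → ℝ) → ℝ} (hm : Measurable h) {C : ℝ} {c : ι → ℝ}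
    (hle : ∀ v, |h v| ≤ C * ∑ i, Real.exp (c i * v i)) :
    ExpIntegrable volume (gaussianStat ι) {θ | θ none < 0} h := by
  classical
  intro θ hθ
  have hmeas : Measurable fun v : ι → ℝ => ∑ j, θ j * gaussianStat ι j v :=
    Finset.measurable_fun_sum _ fun j _ => (measurable_gaussianStat j).const_mul _
  have hint : Integrable fun v : ι → ℝ => C * ∑ k, ∏ i,
      Real.exp (θ none * v i ^ 2 + (θ (some i) + if i = k then c k else 0) * v i) :=
    (integrable_finsetSum _ fun k _ => Integrable.fintype_prod fun i =>
      integrable_exp_quadratic hθ (θ (some i) + if i = k then c k else 0)).const_mul C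
  refine hint.mono' (hm.mul hmeas.exp).aestronglyMeasurable (ae_of_all _ fun v => ?_)
  rw [norm_mul, Real.norm_eq_abs, Real.norm_eq_abs, Real.abs_exp]
  refine (mul_le_mul_of_nonneg_right (hle v) (Real.exp_pos _).le).trans_eq ?_
  rw [mul_assoc, Finset.sum_mul]
  congr 1
  refine Finset.sum_congr rfl fun k _ => ?_
  rw [← Real.exp_sum, ← Real.exp_add, sum_param_mul_gaussianStat]
  congr 1
  simp only [add_mul, ite_mul, zero_mul, Finset.sum_add_distrib, Finset.sum_ite_eq',
    Finset.mem_univ, if_true]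
  ring

variable {h : (ι → ℝ) → ℝ}

lemma hasDerivAt_gaussianMean
    (hh : ExpIntegrable volume (gaussianStat ι) {θ | θ none < 0} h)
    {s : ℝ → ℝ} {b : ℝ → ι → ℝ} {s' : ℝ} {b' : ι → ℝ} {x : ℝ} (hs : HasDerivAt s s' x)
    (hb : ∀ i, HasDerivAt (fun y => b y i) (b' i) x) (hpos : 0 < s x) :
    HasDerivAt (fun y => gaussianMean h (s y) (b y))
      (∑ i, ((b x i ^ 2 * s' / (2 * s x ^ 2) - b x i * b' i / s x - s' / (2 * s x)) *
          gaussianMean h (s x) (b x) +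
        s' / (2 * s x ^ 2) * gaussianMean (fun v => v i * (v i * h v)) (s x) (b x) +
        (b' i / s x - b x i * s' / s x ^ 2) *
          gaussianMean (fun v => v i * h v) (s x) (b x))) x := by
  have hne := hpos.ne'
  have hmem := gaussianParam_mem hpos (b x)
  have hθ : HasDerivAt (fun y => gaussianParam (s y) (b y))
      (fun | none => s' / (2 * s x ^ 2) | some i => b' i / s x - b x i * s' / s x ^ 2) x := by
    refine hasDerivAt_pi.2 fun j => ?_
    cases j with
    | none =>
      refine ((hasDerivAt_const x (-1 : ℝ)).div (hs.const_mul 2) (by positivity)).congr_deriv ?_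
      field_simp
      ring
    | some i =>
      refine ((hb i).div hs hne).congr_deriv ?_
      field_simp
  have hP : HasDerivAt (fun y => ∑ i, (-(b y i ^ 2 / (2 * s y)) - Real.log (s y) / 2))
      (∑ i, (b x i ^ 2 * s' / (2 * s x ^ 2) - b x i * b' i / s x - s' / (2 * s x))) x := by
    refine HasDerivAt.fun_sum fun i _ => ?_
    refine ((((hb i).fun_pow 2).div (hs.const_mul 2) (by positivity)).neg.sub
      ((hs.log hne).div_const 2)).congr_deriv ?_
    push_cast
    field_simp
    ring
  have hM : HasDerivAt (fun y => expIntegral volume (gaussianStat ι) h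
      (gaussianParam (s y) (b y))) _ x :=
    ((hh.hasFDerivAt measurable_gaussianStat isOpen_gaussianDomain hmem).comp_hasDerivAt x hθ :)
  refine ((hP.exp.mul hM).const_mul _).congr_deriv ?_
  have hsq : expIntegral volume (gaussianStat ι) (fun v => gaussianStat ι none v * h v)
      (gaussianParam (s x) (b x)) = ∑ i, expIntegral volume (gaussianStat ι)
        (fun v => v i * (v i * h v)) (gaussianParam (s x) (b x)) := by
    simp only [expIntegral]
    rw [← integral_finsetSum]
    · refine integral_congr_ae (ae_of_all _ fun v => ?_)
      simp only [gaussianStat, Finset.sum_mul]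
      exact Finset.sum_congr rfl fun i _ => by ring
    · exact fun i _ => (hh.mul_stat measurable_gaussianStat isOpen_gaussianDomain
        (some i)).mul_stat measurable_gaussianStat isOpen_gaussianDomain (some i) _ hmem
  simp only [sum_apply, smul_apply, ContinuousLinearMap.proj_apply, smul_eq_mul]
  rw [Fintype.sum_option, hsq]
  simp only [gaussianMean, gaussianStat]
  simp only [Finset.sum_mul, Finset.mul_sum, mul_add, ← Finset.sum_add_distrib]
  exact Finset.sum_congr rfl fun i _ => by ring

lemma contDiffAt_gaussianMean
    (hh : ExpIntegrable volume (gaussianStat ι) {θ | θ none < 0} h)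
    {E : Type*} [NormedAddCommGroup E] [NormedSpace ℝ E] {s : E → ℝ} {b : E → ι → ℝ} {x : E}
    (n : ℕ) (hs : ContDiffAt ℝ n s x) (hb : ∀ i, ContDiffAt ℝ n (fun y => b y i) x)
    (hpos : 0 < s x) : ContDiffAt ℝ n (fun y => gaussianMean h (s y) (b y)) x := by
  have hθ : ContDiffAt ℝ n (fun y => gaussianParam (s y) (b y)) x := by
    refine contDiffAt_pi.2 fun j => ?_
    cases j with
    | none => exact contDiffAt_const.div (contDiffAt_const.mul hs) (by positivity)
    | some i => exact (hb i).div hs hpos.ne'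
  have hM : ContDiffAt ℝ n (expIntegral volume (gaussianStat ι) h)
      (gaussianParam (s x) (b x)) :=
    (hh.contDiffOn measurable_gaussianStat isOpen_gaussianDomain n).contDiffAt
      (isOpen_gaussianDomain.mem_nhds (gaussianParam_mem hpos (b x)))
  have hM' : ContDiffAt ℝ n (fun y => expIntegral volume (gaussianStat ι) h
      (gaussianParam (s y) (b y))) x :=
    (ContDiffAt.comp x hM hθ :)
  refine contDiffAt_const.mul (ContDiffAt.mul (ContDiffAt.exp (ContDiffAt.sum fun i _ => ?_)) hM')
  exact (((hb i).pow 2).div (contDiffAt_const.mul hs) (by positivity)).neg.sub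
    ((hs.log hpos.ne').div_const 2)

end Gaussian

section BlackScholes

variable {ι : Type*}

/-- The normalised logarithmic price at time to maturity `s`: the value of
`(log yᵢ + (μᵢ - σᵢ² / 2) s) / σᵢ`. -/
noncomputable def logPrice (μ σ : ι → ℝ) (s : ℝ) (y : ι → ℝ) (i : ι) : ℝ :=
  (Real.log (y i) + (μ i - σ i ^ 2 / 2) * s) / σ i

lemma isOpen_positiveOrthant [Finite ι] : IsOpen {y : ι → ℝ | ∀ i, 0 < y i} := by
  simp only [Set.ofPred_forall]
  exact isOpen_iInter_of_finite fun i => isOpen_lt continuous_const (continuous_apply i)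

variable [Fintype ι] {μ σ : ι → ℝ} {h : (ι → ℝ) → ℝ}

lemma contDiffAt_gaussianMean_logPrice
    (hh : ExpIntegrable volume (gaussianStat ι) {θ | θ none < 0} h) {s : ℝ} (hs : 0 < s)
    {x : ι → ℝ} (hx : ∀ i, 0 < x i) (n : ℕ) :
    ContDiffAt ℝ n (fun y => gaussianMean h s (logPrice μ σ s y)) x :=
  contDiffAt_gaussianMean hh n contDiffAt_const
    (fun i => (((contDiff_apply ℝ ℝ i).contDiffAt.log (hx i).ne').add contDiffAt_const).div_const _) hs

lemma contDiffAt_gaussianMean_maturity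
    (hh : ExpIntegrable volume (gaussianStat ι) {θ | θ none < 0} h) {T t : ℝ} (ht : t < T)
    (x : ι → ℝ) (n : ℕ) :
    ContDiffAt ℝ n (fun t => gaussianMean h (T - t) (logPrice μ σ (T - t) x)) t := by
  have hT : ContDiffAt ℝ n (fun t : ℝ => T - t) t := contDiffAt_const.sub contDiffAt_id
  exact contDiffAt_gaussianMean hh n hT
    (fun i => (contDiffAt_const.add (contDiffAt_const.mul hT)).div_const _) (sub_pos.2 ht)

lemma hasDerivAt_gaussianMean_maturity
    (hh : ExpIntegrable volume (gaussianStat ι) {θ | θ none < 0} h) {T t : ℝ} (ht : t < T)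
    (x : ι → ℝ) :
    HasDerivAt (fun t => gaussianMean h (T - t) (logPrice μ σ (T - t) x))
      (∑ i, ((-(logPrice μ σ (T - t) x i ^ 2 / (2 * (T - t) ^ 2)) +
            logPrice μ σ (T - t) x i * ((μ i - σ i ^ 2 / 2) / σ i) / (T - t) +
            1 / (2 * (T - t))) * gaussianMean h (T - t) (logPrice μ σ (T - t) x) -
          1 / (2 * (T - t) ^ 2) *
            gaussianMean (fun v => v i * (v i * h v)) (T - t) (logPrice μ σ (T - t) x) +
          (logPrice μ σ (T - t) x i / (T - t) ^ 2 - (μ i - σ i ^ 2 / 2) / σ i / (T - t)) *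
            gaussianMean (fun v => v i * h v) (T - t) (logPrice μ σ (T - t) x))) t := by
  have hT : HasDerivAt (fun t : ℝ => T - t) (-1) t := (hasDerivAt_id t).const_sub T
  refine (hasDerivAt_gaussianMean (b' := fun i => -((μ i - σ i ^ 2 / 2) / σ i)) hh hT
    (fun i => ?_) (sub_pos.2 ht)).congr_deriv ?_
  · refine (((hT.const_mul (μ i - σ i ^ 2 / 2)).const_add (Real.log (x i))).div_const
      (σ i)).congr_deriv (by ring)
  · exact Finset.sum_congr rfl fun i _ => by ring

variable [DecidableEq ι]

lemma hasDerivAt_logPrice_update {x : ι → ℝ} {i : ι} (hx : 0 < x i) (s : ℝ) (j : ι) :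
    HasDerivAt (fun r => logPrice μ σ s (Function.update x i r) j)
      (if j = i then 1 / (σ i * x i) else 0) (x i) := by
  unfold logPrice
  by_cases hj : j = i
  · subst hj
    simp only [Function.update_self, if_true]
    refine (((Real.hasDerivAt_log hx.ne').add_const _).div_const (σ j)).congr_deriv ?_
    rw [one_div, mul_inv, div_eq_mul_inv, mul_comm]
  · simp only [Function.update_of_ne hj, if_neg hj]
    exact hasDerivAt_const _ _

lemma hasDerivAt_gaussianMean_update
    (hh : ExpIntegrable volume (gaussianStat ι) {θ | θ none < 0} h) {s : ℝ} (hs : 0 < s)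
    {x : ι → ℝ} {i : ι} (hx : 0 < x i) :
    HasDerivAt (fun r => gaussianMean h s (logPrice μ σ s (Function.update x i r)))
      (1 / (s * σ i * x i) * (gaussianMean (fun v => v i * h v) s (logPrice μ σ s x) -
        logPrice μ σ s x i * gaussianMean h s (logPrice μ σ s x))) (x i) := by
  refine (hasDerivAt_gaussianMean hh (hasDerivAt_const (x i) s)
    (hasDerivAt_logPrice_update hx s) hs).congr_deriv ?_
  rw [Finset.sum_eq_single i]
  · simp only [Function.update_eq_self, if_true]
    ring
  · intro j _ hj
    simp [hj]
  · simp

lemma fderiv_gaussianMean_single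
    (hh : ExpIntegrable volume (gaussianStat ι) {θ | θ none < 0} h) {s : ℝ} (hs : 0 < s)
    {x : ι → ℝ} (hx : ∀ i, 0 < x i) (i : ι) :
    fderiv ℝ (fun y => gaussianMean h s (logPrice μ σ s y)) x (Pi.single i 1) =
      1 / (s * σ i * x i) * (gaussianMean (fun v => v i * h v) s (logPrice μ σ s x) -
        logPrice μ σ s x i * gaussianMean h s (logPrice μ σ s x)) := by
  have hd := ((contDiffAt_gaussianMean_logPrice (μ := μ) (σ := σ) hh hs hx 1).differentiableAt
    (by simp)).hasFDerivAt
  rw [← Function.update_eq_self i x] at hd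
  have := hd.comp_hasDerivAt (x i) (hasDerivAt_update x i (x i))
  rw [Function.update_eq_self] at this
  exact this.unique (hasDerivAt_gaussianMean_update hh hs (hx i))

lemma iteratedFDeriv_two_gaussianMean_single
    (hh : ExpIntegrable volume (gaussianStat ι) {θ | θ none < 0} h) {s : ℝ} (hs : 0 < s)
    {x : ι → ℝ} (hx : ∀ i, 0 < x i) {i : ι} (hσ : σ i ≠ 0) :
    iteratedFDeriv ℝ 2 (fun y => gaussianMean h s (logPrice μ σ s y)) x
        ![Pi.single i 1, Pi.single i 1] =
      -(1 / (s * σ i * x i ^ 2)) * (gaussianMean (fun v => v i * h v) s (logPrice μ σ s x) -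
        logPrice μ σ s x i * gaussianMean h s (logPrice μ σ s x)) +
      1 / (s * σ i * x i) * (1 / (s * σ i * x i) *
          (gaussianMean (fun v => v i * (v i * h v)) s (logPrice μ σ s x) -
            logPrice μ σ s x i * gaussianMean (fun v => v i * h v) s (logPrice μ σ s x)) -
        (1 / (σ i * x i) * gaussianMean h s (logPrice μ σ s x) +
          logPrice μ σ s x i * (1 / (s * σ i * x i) *
            (gaussianMean (fun v => v i * h v) s (logPrice μ σ s x) -
              logPrice μ σ s x i * gaussianMean h s (logPrice μ σ s x))))) := by
  set f := fun y => gaussianMean h s (logPrice μ σ s y) with hf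
  rw [iteratedFDeriv_two_apply]
  simp only [Matrix.cons_val_zero, Matrix.cons_val_one]
  have hd : DifferentiableAt ℝ (fderiv ℝ f) x :=
    ((contDiffAt_gaussianMean_logPrice (μ := μ) (σ := σ) hh hs hx 2).fderiv_right
      (m := 1) (by norm_num)).differentiableAt (by simp)
  have hd' := hd.hasFDerivAt
  rw [← Function.update_eq_self i x] at hd'
  have h1 := (hd'.comp_hasDerivAt (x i) (hasDerivAt_update x i (x i))).clm_apply
    (hasDerivAt_const (x i) (Pi.single i (1 : ℝ) : ι → ℝ))
  simp only [Function.update_eq_self, map_zero, add_zero] at h1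
  have hh' : ExpIntegrable volume (gaussianStat ι) {θ | θ none < 0} fun v => v i * h v :=
    hh.mul_stat measurable_gaussianStat isOpen_gaussianDomain (some i)
  have hb := hasDerivAt_logPrice_update (μ := μ) (σ := σ) (hx i) s i
  rw [if_pos rfl] at hb
  have hpos : ∀ᶠ r in nhds (x i), ∀ j, 0 < Function.update x i r j := by
    refine (hasDerivAt_update x i (x i)).continuousAt.eventually
      (isOpen_positiveOrthant.mem_nhds ?_)
    rw [Function.update_eq_self]
    exact hx
  have hxi := (hx i).ne'
  have hinv : HasDerivAt (fun r => 1 / (s * σ i * r)) (-(1 / (s * σ i * x i ^ 2))) (x i) := by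
    refine ((hasDerivAt_const (x i) (1 : ℝ)).fun_div ((hasDerivAt_id' (x i)).const_mul (s * σ i))
      (mul_ne_zero (mul_ne_zero hs.ne' hσ) hxi)).congr_deriv ?_
    field_simp
    ring
  have h2 := hinv.fun_mul
    ((hasDerivAt_gaussianMean_update (μ := μ) (σ := σ) hh' hs (hx i)).fun_sub
      (hb.fun_mul (hasDerivAt_gaussianMean_update (μ := μ) (σ := σ) hh hs (hx i))))
  simp only [Function.update_eq_self] at h2
  refine h1.unique (h2.congr_of_eventuallyEq ?_)
  filter_upwards [hpos] with r hr
  have := fderiv_gaussianMean_single (μ := μ) (σ := σ) hh hs hr i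
  rw [Function.update_self] at this
  exact this

lemma gaussianMean_logPrice_blackScholes
    (hh : ExpIntegrable volume (gaussianStat ι) {θ | θ none < 0} h) (hσ : ∀ i, σ i ≠ 0)
    {T t : ℝ} (ht : t < T) {x : ι → ℝ} (hx : ∀ i, 0 < x i) :
    deriv (fun t => gaussianMean h (T - t) (logPrice μ σ (T - t) x)) t
      + (1 / 2) * ∑ i, (σ i) ^ 2 * (x i) ^ 2 *
          iteratedFDeriv ℝ 2 (fun y => gaussianMean h (T - t) (logPrice μ σ (T - t) y)) x
            ![Pi.single i 1, Pi.single i 1]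
      + ∑ i, μ i * x i *
          fderiv ℝ (fun y => gaussianMean h (T - t) (logPrice μ σ (T - t) y)) x
            (Pi.single i 1) = 0 := by
  have hs : 0 < T - t := sub_pos.2 ht
  rw [(hasDerivAt_gaussianMean_maturity hh ht x).deriv, Finset.mul_sum,
    ← Finset.sum_add_distrib, ← Finset.sum_add_distrib]
  refine Finset.sum_eq_zero fun i _ => ?_
  rw [iteratedFDeriv_two_gaussianMean_single hh hs hx (hσ i),
    fderiv_gaussianMean_single hh hs hx i]
  have h1 := hσ i
  have h2 := (hx i).ne'
  have h3 := hs.ne'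
  generalize T - t = s at *
  field_simp
  ring

lemma integral_geometricBrownian_eq_gaussianMean (F : (ι → ℝ) → ℝ) (hσ : ∀ i, σ i ≠ 0)
    {s : ℝ} (hs : 0 < s) {x : ι → ℝ} (hx : ∀ i, 0 < x i) :
    ∫ z, F (fun i => x i * Real.exp (σ i * √s * z i + (μ i - σ i ^ 2 / 2) * s))
        ∂Measure.pi (fun _ : ι => gaussianReal 0 1) =
      gaussianMean (fun v => F fun i => Real.exp (σ i * v i)) s (logPrice μ σ s x) := by
  rw [← integral_pi_gaussianReal_affine hs]
  refine integral_congr_ae (ae_of_all _ fun z => ?_)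
  refine congrArg F (funext fun i => ?_)
  have : σ i * (√s * z i + logPrice μ σ s x i) =
      Real.log (x i) + (σ i * √s * z i + (μ i - σ i ^ 2 / 2) * s) := by
    have := hσ i
    unfold logPrice
    field_simp
    ring
  rw [this, Real.exp_add (Real.log (x i)), Real.exp_log (hx i)]

lemma tendsto_integral_geometricBrownian {F : (ι → ℝ) → ℝ} (hF : Continuous F) {K : ℝ}
    (hle : ∀ y, |F y| ≤ K * ∑ i, |y i|) (hK : 0 ≤ K) (ν : ι → ℝ) (T : ℝ) (x : ι → ℝ) :
    Filter.Tendsto (fun t => ∫ z, F (fun i => x i *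
        Real.exp (σ i * √(T - t) * z i + ν i * (T - t)))
          ∂Measure.pi (fun _ : ι => gaussianReal 0 1))
      (nhdsWithin T (Set.Iio T)) (nhds (F x)) := by
  have hconst : F x = ∫ _, F x ∂Measure.pi (fun _ : ι => gaussianReal 0 1) := by simp
  rw [hconst]
  refine tendsto_integral_filter_of_dominated_convergence
    (fun z => K * ∑ i, |x i| *
      ((Real.exp (σ i * z i) + Real.exp (-σ i * z i)) * Real.exp |ν i|)) ?_ ?_ ?_ ?_
  · refine Filter.Eventually.of_forall fun t => Continuous.aestronglyMeasurable ?_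
    fun_prop
  · have hmem : Set.Ioo (T - 1) T ∈ nhdsWithin T (Set.Iio T) :=
      Ioo_mem_nhdsLT (by linarith)
    filter_upwards [hmem] with t ht
    refine ae_of_all _ fun z => (hle _).trans ?_
    gcongr with i
    rw [abs_mul, Real.abs_exp, Real.exp_add]
    have h0 : 0 ≤ T - t := by linarith [ht.2]
    have h1 : T - t ≤ 1 := by linarith [ht.1]
    have hsqrt : √(T - t) ≤ 1 := Real.sqrt_le_one.2 h1
    gcongr
    · rw [neg_mul]
      refine le_trans (Real.exp_le_exp.2 ?_) (Real.exp_abs_le _)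
      calc σ i * √(T - t) * z i ≤ |σ i * √(T - t) * z i| := le_abs_self _
        _ = √(T - t) * |σ i * z i| := by
          rw [mul_right_comm, abs_mul, abs_of_nonneg (Real.sqrt_nonneg _), mul_comm]
        _ ≤ |σ i * z i| := mul_le_of_le_one_left (abs_nonneg _) hsqrt
    · calc ν i * (T - t) ≤ |ν i| * (T - t) := by gcongr; exact le_abs_self _
        _ ≤ |ν i| := mul_le_of_le_one_right (abs_nonneg _) h1
  · refine (integrable_finsetSum _ fun i _ => Integrable.const_mul (Integrable.mul_const
      (Integrable.add ?_ ?_) _) _).const_mul K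
    · exact integrable_comp_eval (X := fun _ : ι => ℝ) (f := fun w => Real.exp (σ i * w))
        (integrable_exp_mul_gaussianReal (σ i))
    · exact integrable_comp_eval (X := fun _ : ι => ℝ) (f := fun w => Real.exp (-σ i * w))
        (integrable_exp_mul_gaussianReal (-σ i))
  · refine ae_of_all _ fun z => ?_
    have hc : Continuous fun t => F (fun i => x i *
        Real.exp (σ i * √(T - t) * z i + ν i * (T - t))) := by fun_prop
    simpa using (hc.tendsto T).mono_left nhdsWithin_le_nhds

end BlackScholes

section Payoff

variable {ι : Type*} [Finite ι] [Nonempty ι]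

lemma continuous_pi_iSup : Continuous fun x : ι → ℝ => ⨆ i, x i := by
  have := Fintype.ofFinite ι
  simp only [← Finset.sup'_univ_eq_ciSup]
  exact Continuous.finset_sup'_apply _ fun i _ => continuous_apply i

lemma abs_max_iSup_sub_le {ι : Type*} [Fintype ι] [Nonempty ι] {a : ℝ} (ha : 0 ≤ a)
    (x : ι → ℝ) : |max ((⨆ i, x i) - a) 0| ≤ ∑ i, |x i| := by
  rw [abs_of_nonneg (le_max_right _ _)]
  refine max_le ?_ (Finset.sum_nonneg fun i _ => abs_nonneg _)
  have : ⨆ i, x i ≤ ∑ i, |x i| := ciSup_le fun i => (le_abs_self _).trans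
    (Finset.single_le_sum (f := fun i => |x i|) (fun _ _ => abs_nonneg _) (Finset.mem_univ i))
  linarith

end Payoff

/-- Feynman–Kac (geometric Brownian motion) representation solves the Black–Scholes
equation: with payoff `φ(x) = e^{−rT} max(max_i x_i − a, 0)` and
`u(t,x) = ∫ φ(x_i e^{σ_i √(T−t) z_i + (μ_i − σ_i²/2)(T−t)}) dγ_d(z)`, the function `u` is
`C¹` in `t` and `C²` in `x` on `(0,T) × (0,∞)^d`, solves
`∂_t u + ½ Σ_i σ_i² x_i² ∂²u/∂x_i² + Σ_i μ_i x_i ∂u/∂x_i = 0` there, and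
`u(t,x) → φ(x)` as `t → T⁻` for every `x ∈ (0,∞)^d`. -/
theorem black_scholes_representation {d : ℕ} (hd : 1 ≤ d) (T : ℝ) (hT : 0 < T)
    (r a : ℝ) (ha : 0 < a) (μ : Fin d → ℝ) (σ : Fin d → ℝ) (hσ : ∀ i, 0 < σ i) :
    let φ : (Fin d → ℝ) → ℝ := fun x => Real.exp (-r * T) * max ((⨆ i, x i) - a) 0
    let γ : Measure (Fin d → ℝ) := Measure.pi fun _ : Fin d => gaussianReal 0 1
    let u : ℝ → (Fin d → ℝ) → ℝ := fun t x =>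
      ∫ z, φ (fun i => x i *
        Real.exp (σ i * Real.sqrt (T - t) * z i + (μ i - (σ i) ^ 2 / 2) * (T - t))) ∂γ
    (∀ t ∈ Set.Ioo (0 : ℝ) T, ∀ x : Fin d → ℝ, (∀ i, 0 < x i) →
      ContDiffAt ℝ 1 (fun s => u s x) t ∧ ContDiffAt ℝ 2 (fun y => u t y) x) ∧
    (∀ t ∈ Set.Ioo (0 : ℝ) T, ∀ x : Fin d → ℝ, (∀ i, 0 < x i) →
      deriv (fun s => u s x) t
        + (1 / 2) * ∑ i, (σ i) ^ 2 * (x i) ^ 2 *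
            iteratedFDeriv ℝ 2 (fun y => u t y) x ![Pi.single i 1, Pi.single i 1]
        + ∑ i, μ i * x i * fderiv ℝ (fun y => u t y) x (Pi.single i 1) = 0) ∧
    (∀ x : Fin d → ℝ, (∀ i, 0 < x i) →
      Filter.Tendsto (fun t => u t x) (nhdsWithin T (Set.Iio T)) (nhds (φ x))) := by
  intro φ γ u
  have hd' : Nonempty (Fin d) := ⟨⟨0, hd⟩⟩
  have hσ' : ∀ i, σ i ≠ 0 := fun i => (hσ i).ne'
  have hφc : Continuous φ :=
    continuous_const.mul ((continuous_pi_iSup.sub continuous_const).max continuous_const)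
  have hφle : ∀ x, |φ x| ≤ Real.exp (-r * T) * ∑ i, |x i| := by
    intro x
    simp only [φ]
    rw [abs_mul, Real.abs_exp]
    gcongr
    exact abs_max_iSup_sub_le ha.le x
  set g : (Fin d → ℝ) → ℝ := fun v => φ fun i => Real.exp (σ i * v i)
  have hg : ExpIntegrable volume (gaussianStat (Fin d)) {θ | θ none < 0} g := by
    refine expIntegrable_gaussianStat (C := Real.exp (-r * T)) (c := σ)
      (Continuous.measurable (by fun_prop)) fun v => (hφle _).trans_eq ?_
    simp only [Real.abs_exp]
  have hu : ∀ t < T, ∀ x : Fin d → ℝ, (∀ i, 0 < x i) →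
      u t x = gaussianMean g (T - t) (logPrice μ σ (T - t) x) := fun t ht x hx =>
    integral_geometricBrownian_eq_gaussianMean φ hσ' (sub_pos.2 ht) hx
  have hut : ∀ t < T, ∀ x : Fin d → ℝ, (∀ i, 0 < x i) →
      (fun s => u s x) =ᶠ[nhds t]
        fun s => gaussianMean g (T - s) (logPrice μ σ (T - s) x) := by
    intro t ht x hx
    filter_upwards [Iio_mem_nhds ht] with s hs using hu s hs x hx
  have hux : ∀ t < T, ∀ x : Fin d → ℝ, (∀ i, 0 < x i) →
      (fun y => u t y) =ᶠ[nhds x]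
        fun y => gaussianMean g (T - t) (logPrice μ σ (T - t) y) := by
    intro t ht x hx
    filter_upwards [isOpen_positiveOrthant.mem_nhds hx] with y hy using hu t ht y hy
  refine ⟨fun t ht x hx => ⟨?_, ?_⟩, fun t ht x hx => ?_, fun x _ => ?_⟩
  · exact (contDiffAt_gaussianMean_maturity hg ht.2 x 1).congr_of_eventuallyEq
      (hut t ht.2 x hx)
  · exact (contDiffAt_gaussianMean_logPrice hg (sub_pos.2 ht.2) hx 2).congr_of_eventuallyEq
      (hux t ht.2 x hx)
  · rw [(hut t ht.2 x hx).deriv_eq, (hux t ht.2 x hx).fderiv_eq,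
      ((hux t ht.2 x hx).iteratedFDeriv ℝ 2).eq_of_nhds]
    exact gaussianMean_logPrice_blackScholes hg hσ' ht.2 hx
  · exact tendsto_integral_geometricBrownian hφc hφle (Real.exp_pos _).le
      (fun i => μ i - σ i ^ 2 / 2) T x
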